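/- Let ω be fixed and let E^ω_n denote nonconformal partitions of ℝᵈ of the form E^ω_n = ⨉_{j=1}^d λ_j^{(n)} D₀¹ with 0 < λ_j^{(n)} ≤ 1 (products of scaled unit interval partitions). Let θ, ρ be compactly supported probability measures on ℝᵈ and n, k ∈ ℕ. Then H(θ^{*k} * ρ, E^ω_n) − H(ρ, E^ω_n) ≤ k (H(θ * ρ, E^ω_n) − H(ρ, E^ω_n)) + O(k), where θ^{*k} is the k-fold self-convolution of θ and * denotes convolution of measures, and the implied constant depends only on d. -/

import Mathlib

open MeasureTheory


/-- The cell of the product partition `⨉_j λ_j D₀¹` of `ℝᵈ` indexed by `k ∈ ℤᵈ`. -/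
def scaledCell (d : ℕ) (lam : Fin d → ℝ) (k : Fin d → ℤ) : Set (Fin d → ℝ) :=
  {x | ∀ j, (k j : ℝ) * lam j ≤ x j ∧ x j < ((k j : ℝ) + 1) * lam j}

/-- The entropy `H(θ, E)` of a measure w.r.t. the product partition with scales `lam`. -/
noncomputable def scaledEnt {d : ℕ} (θ : Measure (Fin d → ℝ))
    (lam : Fin d → ℝ) : ℝ :=
  ∑' k : Fin d → ℤ, Real.negMulLog ((θ (scaledCell d lam k)).toReal)

/-- The `k`-fold self-convolution `θ^{*k}` (with `θ^{*0} = δ₀`). -/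
noncomputable def convIter {d : ℕ} (θ : Measure (Fin d → ℝ)) : ℕ → Measure (Fin d → ℝ)
  | 0 => Measure.dirac 0
  | k + 1 => MeasureTheory.Measure.conv (convIter θ k) θ


open scoped ENNReal

set_option linter.unusedSectionVars false

section Discrete

variable {G : Type*} [MeasurableSpace G] [Countable G] [MeasurableSingletonClass G]

/-- Entropy of a measure on a countable space. -/
noncomputable def dEnt {G : Type*} [MeasurableSpace G] (μ : Measure G) : ℝ :=
  ∑' g : G, Real.negMulLog ((μ {g}).toReal)

/-- Finitely supported measure. -/
def FinSupp {G : Type*} [MeasurableSpace G] (μ : Measure G) : Prop :=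
  ∃ s : Set G, s.Finite ∧ μ sᶜ = 0

theorem FinSupp.integrable {μ : Measure G} [IsFiniteMeasure μ] (h : FinSupp μ) (f : G → ℝ) :
    Integrable f μ := by
  obtain ⟨s, hs, h0⟩ := h
  have : μ.restrict s = μ := Measure.restrict_eq_self_of_ae_mem (by
    rw [ae_iff]; exact h0)
  rw [← this]
  exact IntegrableOn.of_finite hs

theorem ae_singleton_ne_zero (μ : Measure G) : ∀ᵐ g ∂μ, μ {g} ≠ 0 := by
  rw [ae_iff]
  simp only [not_not]
  rw [← Set.biUnion_of_singleton {a | μ {a} = 0}]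
  rw [measure_biUnion_null_iff (Set.to_countable _)]
  intro i hi
  exact hi

theorem dEnt_eq_integral {μ : Measure G} [IsFiniteMeasure μ] (h : FinSupp μ) :
    dEnt μ = - ∫ g, Real.log ((μ {g}).toReal) ∂μ := by
  rw [integral_countable (h.integrable _), dEnt, ← tsum_neg]
  congr 1
  ext g
  simp [Real.negMulLog, measureReal_def]

theorem dEnt_pull {Ω : Type*} [MeasurableSpace Ω] {Q : Measure Ω} [IsFiniteMeasure Q]
    {T : Ω → G} (hT : Measurable T) {ν : Measure G} (hν : Q.map T = ν) (h : FinSupp ν) :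
    dEnt ν = - ∫ w, Real.log ((ν {T w}).toReal) ∂Q ∧
    Integrable (fun w => Real.log ((ν {T w}).toReal)) Q ∧
    ∀ᵐ w ∂Q, ν {T w} ≠ 0 := by
  have hf : IsFiniteMeasure ν := by rw [← hν]; infer_instance
  refine ⟨?_, ?_, ?_⟩
  · rw [dEnt_eq_integral h]
    congr 1
    conv_lhs => rw [← hν]
    rw [integral_map hT.aemeasurable, hν]
    rw [hν]
    exact (h.integrable _).aestronglyMeasurable
  · have := h.integrable (fun g => Real.log ((ν {g}).toReal))
    rw [← hν] at this
    have := this.comp_measurable hT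
    rwa [hν] at this
  · have := ae_singleton_ne_zero ν
    rw [← hν] at this
    have := ae_of_ae_map hT.aemeasurable this
    rwa [hν] at this

theorem integral_log_le {Ω : Type*} [MeasurableSpace Ω] {Q : Measure Ω} [IsProbabilityMeasure Q]
    {F : Ω → ℝ≥0∞} (hF : AEMeasurable F Q) {N : ℝ} (hN : 0 < N)
    (h0 : ∀ᵐ w ∂Q, F w ≠ 0) (hi : Integrable (fun w => Real.log (F w).toReal) Q)
    (hle : ∫⁻ w, F w ∂Q ≤ ENNReal.ofReal N) :
    ∫ w, Real.log (F w).toReal ∂Q ≤ Real.log N := by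
  have hne : ∫⁻ w, F w ∂Q ≠ ∞ := ne_top_of_le_ne_top ENNReal.ofReal_ne_top hle
  have htop := ae_lt_top' hF hne
  have hint : Integrable (fun w => (F w).toReal) Q := integrable_toReal_of_lintegral_ne_top hF hne
  have hval : ∫ w, (F w).toReal ∂Q ≤ N := by
    rw [integral_toReal hF htop]
    exact ENNReal.toReal_le_of_le_ofReal hN.le hle
  calc ∫ w, Real.log (F w).toReal ∂Q ≤ ∫ w, ((F w).toReal / N + (Real.log N - 1)) ∂Q := by
        refine integral_mono_ae hi ((hint.div_const N).add (integrable_const _)) ?_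
        filter_upwards [h0, htop] with w h1 h2
        have hp : 0 < (F w).toReal := ENNReal.toReal_pos h1 h2.ne
        have := Real.log_le_sub_one_of_pos (div_pos hp hN)
        rw [Real.log_div hp.ne' hN.ne'] at this
        linarith
    _ = (∫ w, (F w).toReal ∂Q) / N + (Real.log N - 1) := by
        rw [integral_add (hint.div_const N) (integrable_const _), integral_div]
        simp
    _ ≤ Real.log N := by
        have : (∫ w, (F w).toReal ∂Q) / N ≤ 1 := by
          rw [div_le_one hN]; exact hval
        linarith

/-- Comparison of entropies of two variables with boundedly many values of one given the other. -/
theorem dEnt_compare {Q : Measure (G × G)} [IsProbabilityMeasure Q] {μ ν : Measure G}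
    (h1 : Q.map Prod.fst = μ) (h2 : Q.map Prod.snd = ν) (f1 : FinSupp μ) (f2 : FinSupp ν)
    (D : G → Finset G) {N : ℕ} (hN : 0 < N) (hD : ∀ b, (D b).card ≤ N)
    (hQ : ∀ᵐ z ∂Q, z.1 ∈ D z.2) : dEnt μ ≤ dEnt ν + Real.log N := by
  classical
  obtain ⟨e1, i1, n1⟩ := dEnt_pull measurable_fst h1 f1
  obtain ⟨e2, i2, n2⟩ := dEnt_pull measurable_snd h2 f2
  have hp1 : IsProbabilityMeasure μ := by
    rw [← h1]; exact Measure.isProbabilityMeasure_map measurable_fst.aemeasurable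
  have hp2 : IsProbabilityMeasure ν := by
    rw [← h2]; exact Measure.isProbabilityMeasure_map measurable_snd.aemeasurable
  set F : G × G → ℝ≥0∞ := fun z => ν {z.2} * (μ {z.1})⁻¹ with hFdef
  have hlog : (fun w => Real.log (F w).toReal) =ᵐ[Q]
      fun w => Real.log (ν {w.2}).toReal - Real.log (μ {w.1}).toReal := by
    filter_upwards [n1, n2] with w a b
    have ha := ENNReal.toReal_pos a (measure_ne_top _ _)
    have hb := ENNReal.toReal_pos b (measure_ne_top _ _)
    simp only [hFdef, ENNReal.toReal_mul, ENNReal.toReal_inv]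
    rw [Real.log_mul hb.ne' (inv_ne_zero ha.ne'), Real.log_inv]
    ring
  have key := integral_log_le (Q := Q) (F := F) (N := N) (measurable_of_countable _).aemeasurable
    (by exact_mod_cast hN) (by
      filter_upwards [n2] with w b
      simp [hFdef, b, measure_ne_top]) ((integrable_congr hlog).2 (i2.sub i1)) (by
      rw [lintegral_countable',
        ENNReal.tsum_prod (f := fun a b => F (a, b) * Q {(a, b)}), ENNReal.tsum_comm]
      calc ∑' b, ∑' a, F (a, b) * Q {(a, b)}
          ≤ ∑' b, ν {b} * N := by
            refine ENNReal.tsum_le_tsum fun b => ?_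
            calc ∑' a, F (a, b) * Q {(a, b)} ≤ ∑' a, ν {b} * (if a ∈ D b then 1 else 0) := by
                  refine ENNReal.tsum_le_tsum fun a => ?_
                  split_ifs with hab
                  · simp only [hFdef]
                    rw [mul_assoc]
                    gcongr
                    have : Q {(a, b)} ≤ μ {a} := by
                      rw [← h1, Measure.map_apply measurable_fst (measurableSet_singleton a)]
                      exact measure_mono (by intro z hz; simp_all)
                    calc (μ {a})⁻¹ * Q {(a, b)} ≤ (μ {a})⁻¹ * μ {a} := by gcongr
                      _ ≤ 1 := ENNReal.inv_mul_le_one _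
                  · have : Q {(a, b)} = 0 := by
                      refine measure_mono_null ?_ (ae_iff.1 hQ)
                      intro z hz
                      simp only [Set.mem_singleton_iff] at hz
                      subst hz
                      exact hab
                    simp [this]
              _ = ν {b} * (D b).card := by
                  rw [ENNReal.tsum_mul_left, tsum_eq_sum (s := D b)]
                  · simp
                  · intro x hx; simp [hx]
              _ ≤ ν {b} * N := by
                  gcongr
                  exact hD b
        _ = ENNReal.ofReal N := by
            rw [ENNReal.tsum_mul_right]
            have : ∑' b, ν {b} = 1 := by
              have := lintegral_countable' (μ := ν) (fun _ => 1)
              simpa using this.symm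
            rw [this]; simp)
  rw [integral_congr_ae hlog, integral_sub i2 i1] at key
  linarith

end Discrete

section KV

variable {G : Type*} [AddCommGroup G] [MeasurableSpace G] [Countable G]
  [MeasurableSingletonClass G] [MeasurableAdd₂ G]

theorem conv_singleton (μ ν : Measure G) [SFinite ν] (w : G) :
    (μ ∗ ν) {w} = ∑' x, μ {x} * ν {w - x} := by
  rw [← lintegral_indicator_one (measurableSet_singleton w),
    Measure.lintegral_conv (measurable_of_countable _), lintegral_countable']
  refine tsum_congr fun x => ?_
  rw [mul_comm]
  congr 1
  rw [← lintegral_indicator_one (measurableSet_singleton _)]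
  refine lintegral_congr fun y => ?_
  by_cases h : x + y = w
  · have h' : y = w - x := by rw [← h]; abel
    simp [h, ← h']
  · have h' : ¬ y = w - x := fun h' => h (by rw [h']; abel)
    simp [h, h']

theorem FinSupp.conv {μ ν : Measure G} [SFinite μ] [SFinite ν] (hμ : FinSupp μ) (hν : FinSupp ν) :
    FinSupp (μ ∗ ν) := by
  obtain ⟨s, hs, h0⟩ := hμ
  obtain ⟨t, ht, h1⟩ := hν
  refine ⟨Set.image2 (· + ·) s t, hs.image2 _ ht, ?_⟩
  rw [Measure.conv, Measure.map_apply (by fun_prop) (Set.to_countable _).measurableSet]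
  refine measure_mono_null (t := (sᶜ ×ˢ Set.univ) ∪ (Set.univ ×ˢ tᶜ)) ?_ ?_
  · rintro ⟨x, y⟩ hxy
    by_contra hc
    simp at hc
    exact hxy ⟨x, hc.1, y, hc.2, rfl⟩
  · rw [measure_union_null_iff]
    simp [Measure.prod_prod, h0, h1]

theorem tsum_singleton_eq_one (ν : Measure G) [IsProbabilityMeasure ν] : ∑' b, ν {b} = 1 := by
  have := lintegral_countable' (μ := ν) (fun _ => 1)
  simpa using this.symm

theorem kv_step (θ ρ μ : Measure G) [IsProbabilityMeasure θ] [IsProbabilityMeasure ρ]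
    [IsProbabilityMeasure μ] (hθ : FinSupp θ) (hρ : FinSupp ρ) (hμ : FinSupp μ) :
    dEnt (θ ∗ (μ ∗ ρ)) - dEnt (μ ∗ ρ) ≤ dEnt (θ ∗ ρ) - dEnt ρ := by
  set Q : Measure (G × G × G) := θ.prod (μ.prod ρ) with hQ
  set W := θ ∗ (μ ∗ ρ) with hW
  set A := θ ∗ ρ with hA
  set B := μ ∗ ρ with hB
  have hWA : W = μ ∗ A := by
    rw [hW, hA, hB, ← Measure.conv_assoc, Measure.conv_comm θ μ, Measure.conv_assoc]
  have m : ∀ {T : G × G × G → G}, Measurable T := fun {T} => measurable_of_countable T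
  have mapY : Q.map (fun z => z.2.2) = ρ := by
    have : (fun z : G × G × G => z.2.2) = Prod.snd ∘ Prod.snd := rfl
    rw [this, ← Measure.map_map measurable_snd measurable_snd, hQ, Measure.map_snd_prod]
    simp
  have mapB : Q.map (fun z => z.2.1 + z.2.2) = B := by
    have : (fun z : G × G × G => z.2.1 + z.2.2) = (fun y : G × G => y.1 + y.2) ∘ Prod.snd := rfl
    rw [this, ← Measure.map_map (by fun_prop) measurable_snd, hQ, Measure.map_snd_prod]
    simp [hB, Measure.conv]
  have mapA : Q.map (fun z => z.1 + z.2.2) = A := by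
    have : (fun z : G × G × G => z.1 + z.2.2) =
      (fun y : G × G => y.1 + y.2) ∘ (Prod.map id Prod.snd) := rfl
    rw [this, ← Measure.map_map (by fun_prop) (by fun_prop), hQ,
      ← Measure.map_prod_map _ _ measurable_id measurable_snd, Measure.map_snd_prod]
    simp [hA, Measure.conv]
  have mapW : Q.map (fun z => z.1 + (z.2.1 + z.2.2)) = W := by
    have : (fun z : G × G × G => z.1 + (z.2.1 + z.2.2)) =
      (fun y : G × G => y.1 + y.2) ∘ (Prod.map id (fun y : G × G => y.1 + y.2)) := rfl
    rw [this, ← Measure.map_map (by fun_prop) (by fun_prop), hQ,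
      ← Measure.map_prod_map _ _ measurable_id (by fun_prop)]
    simp [hW, hB, Measure.conv]
  obtain ⟨eY, iY, nY⟩ := dEnt_pull m mapY hρ
  obtain ⟨eB, iB, nB⟩ := dEnt_pull m mapB (hμ.conv hρ)
  obtain ⟨eA, iA, nA⟩ := dEnt_pull m mapA (hθ.conv hρ)
  obtain ⟨eW, iW, nW⟩ := dEnt_pull m mapW (hθ.conv (hμ.conv hρ))
  have pA : IsProbabilityMeasure A := by rw [hA]; infer_instance
  have pB : IsProbabilityMeasure B := by rw [hB]; infer_instance
  have pW : IsProbabilityMeasure W := by rw [hW]; infer_instance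
  set F : G × G × G → ℝ≥0∞ := fun z =>
    A {z.1 + z.2.2} * B {z.2.1 + z.2.2} * (W {z.1 + (z.2.1 + z.2.2)})⁻¹ * (ρ {z.2.2})⁻¹ with hFdef
  have hlog : (fun w => Real.log (F w).toReal) =ᵐ[Q]
      fun z => Real.log (A {z.1 + z.2.2}).toReal + Real.log (B {z.2.1 + z.2.2}).toReal
        - Real.log (W {z.1 + (z.2.1 + z.2.2)}).toReal - Real.log (ρ {z.2.2}).toReal := by
    filter_upwards [nY, nB, nA, nW] with w y b a v
    have hy := (ENNReal.toReal_pos y (measure_ne_top _ _)).ne'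
    have hb := (ENNReal.toReal_pos b (measure_ne_top _ _)).ne'
    have ha := (ENNReal.toReal_pos a (measure_ne_top _ _)).ne'
    have hv := (ENNReal.toReal_pos v (measure_ne_top _ _)).ne'
    simp only [hFdef, ENNReal.toReal_mul, ENNReal.toReal_inv]
    rw [Real.log_mul (mul_ne_zero (mul_ne_zero ha hb) (inv_ne_zero hv)) (inv_ne_zero hy),
      Real.log_mul (mul_ne_zero ha hb) (inv_ne_zero hv), Real.log_mul ha hb, Real.log_inv, Real.log_inv]
    ring
  have key := integral_log_le (Q := Q) (F := F) (N := 1) (measurable_of_countable _).aemeasurable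
    one_pos (by
      filter_upwards [nA, nB] with w a b
      simp [hFdef, a, b, measure_ne_top])
    ((integrable_congr hlog).2 (((iA.add iB).sub iW).sub iY)) (by
      rw [lintegral_countable']
      calc ∑' z : G × G × G, F z * Q {z}
          ≤ ∑' z : G × G × G, θ {z.1} * μ {z.2.1} * (A {z.1 + z.2.2} * B {z.2.1 + z.2.2} *
              (W {z.1 + (z.2.1 + z.2.2)})⁻¹) := by
            refine ENNReal.tsum_le_tsum fun z => ?_
            obtain ⟨x, z, y⟩ := z
            have : Q {(x, z, y)} = θ {x} * (μ {z} * ρ {y}) := by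
              rw [hQ, ← Set.singleton_prod_singleton, ← Set.singleton_prod_singleton,
                Measure.prod_prod, Measure.prod_prod]
            rw [this]
            simp only [hFdef]
            calc _ = θ {x} * μ {z} * (A {x + y} * B {z + y} * (W {x + (z + y)})⁻¹) *
                  ((ρ {y})⁻¹ * ρ {y}) := by ring
              _ ≤ θ {x} * μ {z} * (A {x + y} * B {z + y} * (W {x + (z + y)})⁻¹) * 1 := by
                  gcongr
                  exact ENNReal.inv_mul_le_one _
              _ = _ := by rw [mul_one]
        _ = ∑' x, ∑' z, ∑' w, θ {x} * μ {z} * (A {w - z} * B {w - x} * (W {w})⁻¹) := by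
            rw [ENNReal.tsum_prod (f := fun x (p : G × G) => θ {x} * μ {p.1} * (A {x + p.2} *
              B {p.1 + p.2} * (W {x + (p.1 + p.2)})⁻¹))]
            refine tsum_congr fun x => ?_
            rw [ENNReal.tsum_prod (f := fun z y => θ {x} * μ {z} * (A {x + y} *
              B {z + y} * (W {x + (z + y)})⁻¹))]
            refine tsum_congr fun z => ?_
            rw [← (Equiv.addLeft (x + z)).tsum_eq (fun w => θ {x} * μ {z} *
              (A {w - z} * B {w - x} * (W {w})⁻¹))]
            refine tsum_congr fun y => ?_
            simp only [Equiv.coe_addLeft]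
            rw [show x + z + y - z = x + y by abel, show x + z + y - x = z + y by abel,
              show x + (z + y) = x + z + y by abel]
        _ = ∑' w, (W {w})⁻¹ * ((∑' x, θ {x} * B {w - x}) * (∑' z, μ {z} * A {w - z})) := by
            have : ∀ x, ∑' z, ∑' w, θ {x} * μ {z} * (A {w - z} * B {w - x} * (W {w})⁻¹) =
              ∑' w, ∑' z, θ {x} * μ {z} * (A {w - z} * B {w - x} * (W {w})⁻¹) :=
              fun x => ENNReal.tsum_comm
            simp_rw [this]
            rw [ENNReal.tsum_comm]
            refine tsum_congr fun w => ?_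
            rw [← ENNReal.tsum_mul_right, ← ENNReal.tsum_mul_left]
            refine tsum_congr fun x => ?_
            rw [← ENNReal.tsum_mul_left, ← ENNReal.tsum_mul_left]
            refine tsum_congr fun z => ?_
            ring
        _ = ∑' w, (W {w})⁻¹ * (W {w} * W {w}) := by
            refine tsum_congr fun w => ?_
            rw [← conv_singleton, ← conv_singleton, ← hWA]
        _ ≤ ∑' w, W {w} := by
            refine ENNReal.tsum_le_tsum fun w => ?_
            rw [← mul_assoc]
            calc _ ≤ 1 * W {w} := by gcongr; exact ENNReal.inv_mul_le_one _
              _ = _ := one_mul _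
        _ = ENNReal.ofReal 1 := by rw [tsum_singleton_eq_one]; simp)
  have hint : ∫ z, (Real.log (A {z.1 + z.2.2}).toReal + Real.log (B {z.2.1 + z.2.2}).toReal
        - Real.log (W {z.1 + (z.2.1 + z.2.2)}).toReal - Real.log (ρ {z.2.2}).toReal) ∂Q
      = - dEnt A - dEnt B + dEnt W + dEnt ρ := by
    have e1 := integral_sub ((iA.add iB).sub iW) iY
    have e2 := integral_sub (iA.add iB) iW
    have e3 := integral_add iA iB
    simp only [Pi.add_apply, Pi.sub_apply] at e1 e2 e3
    linarith
  rw [integral_congr_ae hlog, hint, Real.log_one] at key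
  linarith

end KV

section Bridge

theorem kv_discrete {G : Type*} [AddCommGroup G] [MeasurableSpace G] [Countable G]
    [MeasurableSingletonClass G] [MeasurableAdd₂ G] (θ ρ : Measure G)
    [IsProbabilityMeasure θ] [IsProbabilityMeasure ρ] (hθ : FinSupp θ) (hρ : FinSupp ρ)
    (P : ℕ → Measure G) (h0 : P 0 = Measure.dirac 0) (hs : ∀ k, P (k + 1) = P k ∗ θ) (k : ℕ) :
    IsProbabilityMeasure (P k) ∧ FinSupp (P k) ∧
      dEnt (P k ∗ ρ) - dEnt ρ ≤ k * (dEnt (θ ∗ ρ) - dEnt ρ) := by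
  induction k with
  | zero =>
    rw [h0]
    refine ⟨inferInstance, ⟨{0}, Set.finite_singleton _, by simp⟩, ?_⟩
    rw [Measure.dirac_zero_conv]
    simp
  | succ k ih =>
    obtain ⟨h1, h2, h3⟩ := ih
    rw [hs]
    refine ⟨inferInstance, h2.conv hθ, ?_⟩
    have := kv_step θ ρ (P k) hθ hρ h2
    rw [← Measure.conv_assoc, Measure.conv_comm θ (P k)] at this
    push_cast
    linarith

/-- The index of the cell containing `x`. -/
noncomputable def cellIdx {d : ℕ} (lam : Fin d → ℝ) (x : Fin d → ℝ) : Fin d → ℤ :=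
  fun j => ⌊x j / lam j⌋

theorem measurable_cellIdx {d : ℕ} (lam : Fin d → ℝ) : Measurable (cellIdx lam) := by
  refine measurable_pi_lambda _ fun j => ?_
  exact ((measurable_pi_apply j).div_const _).floor

theorem scaledEnt_eq {d : ℕ} {lam : Fin d → ℝ} (hl : ∀ j, 0 < lam j)
    (μ : Measure (Fin d → ℝ)) : scaledEnt μ lam = dEnt (μ.map (cellIdx lam)) := by
  unfold scaledEnt dEnt
  refine tsum_congr fun k => ?_
  rw [Measure.map_apply (measurable_cellIdx lam) (measurableSet_singleton k)]
  congr 3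
  ext x
  simp only [scaledCell, Set.mem_ofPred_eq, Set.mem_preimage, Set.mem_singleton_iff, funext_iff,
    cellIdx, Int.floor_eq_iff]
  refine forall_congr' fun j => ?_
  rw [le_div_iff₀ (hl j), div_lt_iff₀ (hl j)]

theorem finSupp_map {d : ℕ} {lam : Fin d → ℝ} (hl : ∀ j, 0 < lam j)
    (μ : Measure (Fin d → ℝ)) (h : ∃ K : Set (Fin d → ℝ), IsCompact K ∧ μ Kᶜ = 0) :
    FinSupp (μ.map (cellIdx lam)) := by
  obtain ⟨K, hK, h0⟩ := h
  obtain ⟨R, hR⟩ := hK.isBounded.exists_norm_le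
  refine ⟨(Fintype.piFinset (fun j => Finset.Icc ⌊-R / lam j⌋ ⌊R / lam j⌋) : Finset (Fin d → ℤ)),
    Finset.finite_toSet _, ?_⟩
  rw [Measure.map_apply (measurable_cellIdx lam) (Set.to_countable _).measurableSet]
  refine measure_mono_null ?_ h0
  intro x hx hxK
  apply hx
  simp only [Finset.mem_coe, Fintype.mem_piFinset, Finset.mem_Icc, cellIdx]
  intro j
  have h1 := (norm_le_pi_norm x j).trans (hR x hxK)
  rw [Real.norm_eq_abs, abs_le] at h1
  have := hl j
  constructor
  · apply Int.floor_le_floor; gcongr; exact h1.1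
  · apply Int.floor_le_floor; gcongr; exact h1.2

/-- A coupling of `μ` and `ν` with the rescaled difference in `[0,k]`. -/
def Coup {d : ℕ} (lam : Fin d → ℝ) (k : ℕ) (μ : Measure (Fin d → ℝ))
    (ν : Measure (Fin d → ℤ)) : Prop :=
  ∃ π : Measure ((Fin d → ℝ) × (Fin d → ℤ)), IsProbabilityMeasure π ∧ π.map Prod.fst = μ ∧
    π.map Prod.snd = ν ∧
    ∀ᵐ z ∂π, ∀ j, (z.2 j : ℝ) ≤ z.1 j / lam j ∧ z.1 j / lam j ≤ z.2 j + k

theorem measurableSet_coup {d : ℕ} (lam : Fin d → ℝ) (k : ℕ) :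
    MeasurableSet {z : (Fin d → ℝ) × (Fin d → ℤ) |
      ∀ j, (z.2 j : ℝ) ≤ z.1 j / lam j ∧ z.1 j / lam j ≤ z.2 j + k} := by
  rw [Set.ofPred_forall]
  refine MeasurableSet.iInter fun j => ?_
  have m1 : Measurable fun z : (Fin d → ℝ) × (Fin d → ℤ) => z.1 j / lam j :=
    ((measurable_pi_apply j).comp measurable_fst).div_const _
  have m2 : Measurable fun z : (Fin d → ℝ) × (Fin d → ℤ) => (z.2 j : ℝ) :=
    (measurable_of_countable (fun n : ℤ => (n : ℝ))).comp
      ((measurable_pi_apply j).comp measurable_snd)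
  exact (measurableSet_le m2 m1).inter (measurableSet_le m1 (m2.add_const _))

theorem Coup.conv {d : ℕ} {lam : Fin d → ℝ} {k l : ℕ} {μ μ' : Measure (Fin d → ℝ)}
    {ν ν' : Measure (Fin d → ℤ)} (h : Coup lam k μ ν) (h' : Coup lam l μ' ν') :
    Coup lam (k + l) (μ ∗ μ') (ν ∗ ν') := by
  obtain ⟨π, hp, rfl, rfl, ha⟩ := h
  obtain ⟨π', hp', rfl, rfl, ha'⟩ := h'
  refine ⟨π ∗ π', inferInstance, ?_, ?_, ?_⟩
  · exact Measure.map_conv_addMonoidHom (AddMonoidHom.fst (Fin d → ℝ) (Fin d → ℤ)) measurable_fst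
  · exact Measure.map_conv_addMonoidHom (AddMonoidHom.snd (Fin d → ℝ) (Fin d → ℤ)) measurable_snd
  · rw [Measure.conv, ae_map_iff (by fun_prop) (measurableSet_coup lam (k + l))]
    filter_upwards [Measure.quasiMeasurePreserving_fst.ae ha,
      Measure.quasiMeasurePreserving_snd.ae ha'] with z h1 h2
    intro j
    have h1 := h1 j
    have h2 := h2 j
    simp only [Prod.fst_add, Prod.snd_add, Pi.add_apply, add_div]
    push_cast
    constructor <;> linarith

theorem coup_self {d : ℕ} (lam : Fin d → ℝ) (μ : Measure (Fin d → ℝ)) [IsProbabilityMeasure μ] :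
    Coup lam 1 μ (μ.map (cellIdx lam)) := by
  have hm := measurable_cellIdx lam
  have hm2 : Measurable (fun x => (x, cellIdx lam x)) := measurable_id.prodMk hm
  refine ⟨μ.map (fun x => (x, cellIdx lam x)), Measure.isProbabilityMeasure_map hm2.aemeasurable,
    ?_, ?_, ?_⟩
  · rw [Measure.map_map measurable_fst hm2]
    exact Measure.map_id
  · rw [Measure.map_map measurable_snd hm2]
    rfl
  · rw [ae_map_iff hm2.aemeasurable (measurableSet_coup lam 1)]
    refine Filter.Eventually.of_forall fun x j => ?_
    simp only [cellIdx]
    push_cast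
    exact ⟨Int.floor_le _, (Int.lt_floor_add_one _).le⟩

theorem coup_zero {d : ℕ} (lam : Fin d → ℝ) :
    Coup lam 0 (Measure.dirac 0) (Measure.dirac 0) := by
  refine ⟨Measure.dirac 0, inferInstance, ?_, ?_, ?_⟩
  · rw [Measure.map_dirac' measurable_fst]; rfl
  · rw [Measure.map_dirac' measurable_snd]; rfl
  · rw [ae_dirac_iff (measurableSet_coup lam 0)]
    intro j
    simp

theorem Coup.compare {d : ℕ} {lam : Fin d → ℝ} {k : ℕ} {μ : Measure (Fin d → ℝ)}
    {ν : Measure (Fin d → ℤ)} (h : Coup lam k μ ν) (hν : FinSupp ν) :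
    dEnt (μ.map (cellIdx lam)) ≤ dEnt ν + d * Real.log (k + 1) ∧
    dEnt ν ≤ dEnt (μ.map (cellIdx lam)) + d * Real.log (k + 1) := by
  obtain ⟨π, hp, h1, h2, ha⟩ := h
  have hm : Measurable (fun z : (Fin d → ℝ) × (Fin d → ℤ) => (cellIdx lam z.1, z.2)) :=
    ((measurable_cellIdx lam).comp measurable_fst).prodMk measurable_snd
  have hm' : Measurable (fun z : (Fin d → ℝ) × (Fin d → ℤ) => (z.2, cellIdx lam z.1)) :=
    measurable_snd.prodMk ((measurable_cellIdx lam).comp measurable_fst)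
  have hfl : ∀ᵐ z ∂π, ∀ j, z.2 j ≤ cellIdx lam z.1 j ∧ cellIdx lam z.1 j ≤ z.2 j + k := by
    filter_upwards [ha] with z hz j
    refine ⟨Int.le_floor.2 (hz j).1, ?_⟩
    have : (cellIdx lam z.1 j : ℝ) ≤ z.2 j + k := (Int.floor_le _).trans (hz j).2
    exact_mod_cast this
  let D : (Fin d → ℤ) → Finset (Fin d → ℤ) := fun b =>
    Fintype.piFinset (fun j => Finset.Icc (b j) (b j + k))
  let D' : (Fin d → ℤ) → Finset (Fin d → ℤ) := fun b =>
    Fintype.piFinset (fun j => Finset.Icc (b j - k) (b j))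
  have hD : ∀ b, (D b).card ≤ (k + 1) ^ d := by
    intro b
    simp only [D, Fintype.card_piFinset, Int.card_Icc]
    rw [Finset.prod_congr rfl (g := fun _ => k + 1) (fun j _ => by omega)]
    simp
  have hD' : ∀ b, (D' b).card ≤ (k + 1) ^ d := by
    intro b
    simp only [D', Fintype.card_piFinset, Int.card_Icc]
    rw [Finset.prod_congr rfl (g := fun _ => k + 1) (fun j _ => by omega)]
    simp
  have hmem : ∀ᵐ z ∂π, cellIdx lam z.1 ∈ D z.2 := by
    filter_upwards [hfl] with z hz
    simpa [D, Fintype.mem_piFinset] using hz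
  have hmem' : ∀ᵐ z ∂π, z.2 ∈ D' (cellIdx lam z.1) := by
    filter_upwards [hfl] with z hz
    simp only [D', Fintype.mem_piFinset, Finset.mem_Icc]
    intro j
    have := hz j
    omega
  have hμeq : π.map (fun z => cellIdx lam z.1) = μ.map (cellIdx lam) := by
    rw [← h1, Measure.map_map (measurable_cellIdx lam) measurable_fst]
    rfl
  have hμ : FinSupp (μ.map (cellIdx lam)) := by
    obtain ⟨s, hs, h0⟩ := hν
    refine ⟨⋃ b ∈ s, (D b : Set (Fin d → ℤ)), hs.biUnion fun b _ => Finset.finite_toSet _, ?_⟩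
    rw [← hμeq, Measure.map_apply (f := fun z : (Fin d → ℝ) × (Fin d → ℤ) => cellIdx lam z.1)
      ((measurable_cellIdx lam).comp measurable_fst) (Set.to_countable _).measurableSet]
    rw [← h2, Measure.map_apply measurable_snd (Set.to_countable _).measurableSet] at h0
    refine measure_mono_null ?_ (measure_union_null h0 (ae_iff.1 hmem))
    intro z hz
    by_contra hc
    simp only [Set.mem_union, Set.mem_preimage, Set.mem_compl_iff, Set.mem_ofPred_eq, not_or,
      not_not] at hc
    apply hz
    simp only [Set.mem_iUnion]
    exact ⟨z.2, hc.1, hc.2⟩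
  have hlog : Real.log (((k + 1) ^ d : ℕ) : ℝ) = d * Real.log (k + 1) := by
    push_cast
    rw [Real.log_pow]
  have p1 := Measure.isProbabilityMeasure_map (μ := π) hm.aemeasurable
  have p2 := Measure.isProbabilityMeasure_map (μ := π) hm'.aemeasurable
  constructor
  · rw [← hlog]
    refine dEnt_compare (Q := π.map _) (D := D) ?_ ?_ hμ hν (by positivity) hD
      ((ae_map_iff hm.aemeasurable (Set.to_countable _).measurableSet).2 hmem)
    · rw [Measure.map_map measurable_fst hm, ← hμeq]
      rfl
    · rw [Measure.map_map measurable_snd hm, ← h2]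
      rfl
  · rw [← hlog]
    refine dEnt_compare (Q := π.map _) (D := D') ?_ ?_ hν hμ (by positivity) hD'
      ((ae_map_iff hm'.aemeasurable (Set.to_countable _).measurableSet).2 hmem')
    · rw [Measure.map_map measurable_fst hm', ← h2]
      rfl
    · rw [Measure.map_map measurable_snd hm', ← hμeq]
      rfl

/-- Iterated convolution of the discretised measure. -/
noncomputable def dIter {d : ℕ} (θ : Measure (Fin d → ℤ)) : ℕ → Measure (Fin d → ℤ)
  | 0 => Measure.dirac 0
  | k + 1 => dIter θ k ∗ θ

theorem coup_iter {d : ℕ} (lam : Fin d → ℝ) (θ : Measure (Fin d → ℝ)) [IsProbabilityMeasure θ]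
    (k : ℕ) : Coup lam k (convIter θ k) (dIter (θ.map (cellIdx lam)) k) := by
  induction k with
  | zero => exact coup_zero lam
  | succ k ih => exact ih.conv (coup_self lam θ)

end Bridge

/-- Kaimanovich–Vershik type lemma along nonconformal partitions `E^ω_n`:
`H(θ^{*k} ∗ ρ, E) − H(ρ, E) ≤ k (H(θ ∗ ρ, E) − H(ρ, E)) + O(k)`, with the implied
constant depending only on `d`. -/
theorem kaimanovich_vershik_scaled
    (d : ℕ) :
    ∃ C > 0, ∀ lam : Fin d → ℝ, (∀ j, 0 < lam j ∧ lam j ≤ 1) →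
      ∀ (θ ρ : Measure (Fin d → ℝ)),
        MeasureTheory.IsProbabilityMeasure θ →
        MeasureTheory.IsProbabilityMeasure ρ →
        (∃ K : Set (Fin d → ℝ), IsCompact K ∧ θ Kᶜ = 0) →
        (∃ K : Set (Fin d → ℝ), IsCompact K ∧ ρ Kᶜ = 0) →
        ∀ k : ℕ,
          scaledEnt (MeasureTheory.Measure.conv (convIter θ k) ρ) lam - scaledEnt ρ lam ≤
            (k : ℝ) * (scaledEnt (MeasureTheory.Measure.conv θ ρ) lam - scaledEnt ρ lam) + C * k := by
  refine ⟨4 * d + 1, by positivity, ?_⟩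
  intro lam hlam θ ρ hθ hρ cθ cρ k
  have hl : ∀ j, 0 < lam j := fun j => (hlam j).1
  have pθ : IsProbabilityMeasure (θ.map (cellIdx lam)) :=
    Measure.isProbabilityMeasure_map (measurable_cellIdx lam).aemeasurable
  have pρ : IsProbabilityMeasure (ρ.map (cellIdx lam)) :=
    Measure.isProbabilityMeasure_map (measurable_cellIdx lam).aemeasurable
  have fθ := finSupp_map hl θ cθ
  have fρ := finSupp_map hl ρ cρ
  obtain ⟨q1, q2, q3⟩ := kv_discrete (θ.map (cellIdx lam)) (ρ.map (cellIdx lam)) fθ fρ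
    (dIter (θ.map (cellIdx lam))) rfl (fun _ => rfl) k
  rcases Nat.eq_zero_or_pos k with rfl | hk
  · simp only [convIter]
    rw [Measure.dirac_zero_conv]
    simp
  · have c1 := (((coup_iter lam θ k).conv (coup_self lam ρ)).compare (q2.conv fρ)).1
    have c2 := (((coup_self lam θ).conv (coup_self lam ρ)).compare (fθ.conv fρ)).2
    rw [scaledEnt_eq hl, scaledEnt_eq hl, scaledEnt_eq hl]
    have hk1 : (1 : ℝ) ≤ k := by exact_mod_cast hk
    push_cast at c1 c2
    have l1 : Real.log ((k : ℝ) + 1 + 1) ≤ 2 * k := by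
      have := Real.log_le_sub_one_of_pos (show (0 : ℝ) < (k : ℝ) + 1 + 1 by positivity)
      linarith
    have l2 : Real.log ((2 : ℝ) + 1) ≤ 2 := by
      have := Real.log_le_sub_one_of_pos (show (0 : ℝ) < (2 : ℝ) + 1 by positivity)
      linarith
    have d0 : (0 : ℝ) ≤ d := Nat.cast_nonneg d
    have m1 := mul_le_mul_of_nonneg_left l1 d0
    have m2 := mul_le_mul_of_nonneg_left l2 d0
    have m3 := mul_le_mul_of_nonneg_left (c2.trans (add_le_add_right m2 _))
      (show (0 : ℝ) ≤ k by positivity)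
    nlinarith
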